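/- arXiv:math/0612048 — 3 statements merged into one kernel-verified Lean document; each statement's English description precedes it below -/
import Mathlib

section
/- Let c := sup_{k≥2} (w(k-1)+w(1))/w(k-1) (finite under (A0)). Then for all integers k ≥ 3 and all integers ℓ with 1 ≤ ℓ < k/2, one has (w(1)/c)·P^{1,1}(Z_∞ = 1)·(w(k-ℓ)+w(ℓ))/(w(k-ℓ)w(ℓ)) ≤ P^{1,1}(Z_k = ℓ) ≤ w(1)·(w(k-ℓ)+w(ℓ))/(w(k-ℓ)w(ℓ)). -/
/-!
Statement 0 (Proposition 2(a) of Cotar–Limic, "Attraction time for strongly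
reinforced walks").

Setup: `w : ℕ → ℝ` is a reinforcement weight function, positive on `{1,2,...}`,
satisfying (A0): `∑_{k ≥ 1} 1/w(k) < ∞`.  The two-edge ERRW with law `P^{a,b}`
is the Markov chain `(G_n, R_n)_{n ≥ a+b}` with `(G_{a+b}, R_{a+b}) = (a,b)`
which moves from `(g,r)` to `(g+1,r)` with probability `w(g)/(w(g)+w(r))` and to
`(g,r+1)` with probability `w(r)/(w(g)+w(r))`.  We encode a trajectory by the
sequence of choices `ω : ℕ → Bool` (`true` = green edge incremented), and we
characterize the law `P` by its values on cylinder sets.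
-/

open MeasureTheory Finset

namespace AttractionTime

/-- Number of green increments among the first `i` steps. -/
def greenCount (ω : ℕ → Bool) (i : ℕ) : ℕ :=
  ((Finset.range i).filter fun j => ω j = true).card

/-- Green edge weight after `i` steps, starting from `a`. -/
def Gw (a : ℕ) (ω : ℕ → Bool) (i : ℕ) : ℕ := a + greenCount ω i

/-- Red edge weight after `i` steps, starting from `b`. -/
def Rw (b : ℕ) (ω : ℕ → Bool) (i : ℕ) : ℕ := b + (i - greenCount ω i)

/-- Transition probability of the `i`-th step of the trajectory `s`. -/
noncomputable def stepProb (w : ℕ → ℝ) (a b : ℕ) (s : ℕ → Bool) (i : ℕ) : ℝ :=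
  if s i then w (Gw a s i) / (w (Gw a s i) + w (Rw b s i))
  else w (Rw b s i) / (w (Gw a s i) + w (Rw b s i))

/-- `Z_n = min (G_n, R_n)`, where time `n ≥ a+b` corresponds to `n - (a+b)` steps. -/
def Z (a b : ℕ) (ω : ℕ → Bool) (n : ℕ) : ℕ :=
  min (Gw a ω (n - (a + b))) (Rw b ω (n - (a + b)))

/-- `Z_∞ = sup_n Z_n ∈ ℕ ∪ {∞}`. -/
noncomputable def Zinf (a b : ℕ) (ω : ℕ → Bool) : ℕ∞ := ⨆ n, (Z a b ω n : ℕ∞)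

/-- The law `P^{a,b}` : a probability measure on trajectories whose cylinder
probabilities are the products of the transition probabilities. -/
def IsTwoEdgeLaw (w : ℕ → ℝ) (a b : ℕ) (P : Measure (ℕ → Bool)) : Prop :=
  ∀ (m : ℕ) (s : ℕ → Bool),
    (P {ω | ∀ i < m, ω i = s i}).toReal = ∏ i ∈ Finset.range m, stepProb w a b s i

end AttractionTime

namespace AttractionTime

lemma greenCount_succ (ω : ℕ → Bool) (n : ℕ) :
    greenCount ω (n + 1) = greenCount ω n + if ω n = true then 1 else 0 := by
  unfold greenCount
  rw [Finset.range_add_one, Finset.filter_insert]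
  split_ifs with h
  · rw [Finset.card_insert_of_notMem (by simp)]
  · rfl

lemma greenCount_le (ω : ℕ → Bool) (n : ℕ) : greenCount ω n ≤ n := by
  simpa [greenCount] using Finset.card_filter_le (Finset.range n) fun j => ω j = true

lemma measurableSet_apply_eq (n : ℕ) (b : Bool) : MeasurableSet {ω : ℕ → Bool | ω n = b} :=
  measurableSet_eq_fun (measurable_pi_apply n) measurable_const

lemma measurable_greenCount (n : ℕ) : Measurable fun ω : ℕ → Bool => greenCount ω n := by
  induction n with
  | zero => simp [greenCount]
  | succ n ih =>
    simp only [greenCount_succ]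
    exact ih.add (Measurable.ite (measurableSet_apply_eq n true) measurable_const measurable_const)

lemma measurableSet_greenCount_eq (n g : ℕ) :
    MeasurableSet {ω : ℕ → Bool | greenCount ω n = g} :=
  measurable_greenCount n (measurableSet_singleton g)

/-- The trajectories that agree with `s` in the first `n` steps. -/
def prefixCylinder (n : ℕ) (s : ℕ → Bool) : Set (ℕ → Bool) := {ω | ∀ i < n, ω i = s i}

lemma measurableSet_prefixCylinder (n : ℕ) (s : ℕ → Bool) :
    MeasurableSet (prefixCylinder n s) := by
  have : prefixCylinder n s = ⋂ i ∈ Set.Iio n, (fun ω : ℕ → Bool => ω i) ⁻¹' {s i} := by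
    ext ω; simp [prefixCylinder]
  rw [this]
  exact MeasurableSet.biInter (Set.to_countable _)
    fun i _ => measurable_pi_apply i (measurableSet_singleton _)

/-- The trajectory whose green steps before time `n` are those in `A`, and which is constantly `b`
from time `n` on. -/
def trajectoryOf (n : ℕ) (b : Bool) (A : Finset ℕ) (i : ℕ) : Bool :=
  if i < n then decide (i ∈ A) else b

lemma greenCount_trajectoryOf {n : ℕ} (b : Bool) {A : Finset ℕ} (hA : A ⊆ Finset.range n) :
    greenCount (trajectoryOf n b A) n = A.card := by
  unfold greenCount
  congr 1
  ext i
  rw [mem_filter, mem_range]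
  unfold trajectoryOf
  refine ⟨fun h => ?_, fun h => ?_⟩
  · simpa [h.1] using h.2
  · have := mem_range.1 (hA h)
    simp [this, h]

lemma disjoint_prefixCylinder {n m : ℕ} (hnm : n ≤ m) (b : Bool) {A B : Finset ℕ}
    (hA : A ⊆ Finset.range n) (hB : B ⊆ Finset.range n) (hAB : A ≠ B) :
    Disjoint (prefixCylinder m (trajectoryOf n b A)) (prefixCylinder m (trajectoryOf n b B)) := by
  rw [Set.disjoint_left]
  intro ω h1 h2
  apply hAB
  ext i
  by_cases hi : i < n
  · have := (h1 i (by omega)).symm.trans (h2 i (by omega))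
    simpa [trajectoryOf, hi] using this
  · exact ⟨fun h => absurd (mem_range.1 (hA h)) hi, fun h => absurd (mem_range.1 (hB h)) hi⟩

lemma mem_prefixCylinder_filter (n : ℕ) (b : Bool) (ω : ℕ → Bool) :
    ω ∈ prefixCylinder n (trajectoryOf n b ((Finset.range n).filter fun j => ω j = true)) := by
  intro i hi
  simp [trajectoryOf, hi]

lemma greenCount_congr {n : ℕ} {ω s : ℕ → Bool} (h : ω ∈ prefixCylinder n s) :
    greenCount ω n = greenCount s n := by
  unfold greenCount
  congr 1
  exact Finset.filter_congr fun i hi => by rw [h i (mem_range.1 hi)]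

lemma setOf_greenCount_eq (n g : ℕ) (b : Bool) :
    {ω : ℕ → Bool | greenCount ω n = g} =
      ⋃ A ∈ Finset.powersetCard g (Finset.range n), prefixCylinder n (trajectoryOf n b A) := by
  ext ω
  simp only [Set.mem_ofPred_eq, Set.mem_iUnion, mem_powersetCard, exists_prop]
  constructor
  · intro h
    exact ⟨_, ⟨Finset.filter_subset _ _, h⟩, mem_prefixCylinder_filter n b ω⟩
  · rintro ⟨A, ⟨hA, rfl⟩, h⟩
    rw [greenCount_congr h, greenCount_trajectoryOf b hA]

lemma setOf_greenCount_eq_and (n g : ℕ) (b : Bool) :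
    {ω : ℕ → Bool | greenCount ω n = g ∧ ω n = b} =
      ⋃ A ∈ Finset.powersetCard g (Finset.range n),
        prefixCylinder (n + 1) (trajectoryOf n b A) := by
  have key : ∀ (A : Finset ℕ) (ω : ℕ → Bool), ω ∈ prefixCylinder (n + 1) (trajectoryOf n b A) ↔
      ω ∈ prefixCylinder n (trajectoryOf n b A) ∧ ω n = b := by
    intro A ω
    simp only [prefixCylinder, Set.mem_ofPred_eq, Nat.forall_lt_succ_right]
    simp [trajectoryOf]
  have h := setOf_greenCount_eq n g b
  ext ω
  have hω := Set.ext_iff.1 h ω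
  simp only [Set.mem_ofPred_eq, Set.mem_iUnion, exists_prop] at hω
  simp only [Set.mem_ofPred_eq, Set.mem_iUnion, exists_prop, key, hω]
  tauto

/-- The probability of visiting the state with `a` green and `b` red increments. -/
noncomputable def visitProb (P : Measure (ℕ → Bool)) (a b : ℕ) : ℝ :=
  P.real {ω | greenCount ω (a + b) = a}

variable {w : ℕ → ℝ} {P : Measure (ℕ → Bool)}

/-- The visit probability of an unordered state, normalized so that its recursion becomes a
convex combination. -/
noncomputable def normVisitProb (w : ℕ → ℝ) (P : Measure (ℕ → Bool)) (a b : ℕ) : ℝ :=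
  (visitProb P a b + visitProb P b a) / (1 / w (1 + a) + 1 / w (1 + b))

lemma normVisitProb_comm (a b : ℕ) : normVisitProb w P a b = normVisitProb w P b a := by
  unfold normVisitProb
  rw [add_comm (visitProb P a b), add_comm (1 / w (1 + a))]

lemma normVisitProb_nonneg (hw : ∀ k, 1 ≤ k → 0 < w k) (a b : ℕ) : 0 ≤ normVisitProb w P a b := by
  have := hw (1 + a) (by omega)
  have := hw (1 + b) (by omega)
  unfold normVisitProb visitProb
  positivity

variable [IsProbabilityMeasure P]

/-- The Markov property of the green count. -/
lemma IsTwoEdgeLaw.measureReal_greenCount_and (hP : IsTwoEdgeLaw w 1 1 P) (n g : ℕ) (b : Bool) :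
    P.real {ω | greenCount ω n = g ∧ ω n = b} = P.real {ω | greenCount ω n = g} *
      ((if b then w (1 + g) else w (1 + (n - g))) / (w (1 + g) + w (1 + (n - g)))) := by
  have hdisj : ∀ m, n ≤ m → Set.PairwiseDisjoint
      (↑(Finset.powersetCard g (Finset.range n)) : Set (Finset ℕ))
      (fun A => prefixCylinder m (trajectoryOf n b A)) := by
    intro m hm A hA B hB hAB
    exact disjoint_prefixCylinder hm b (mem_powersetCard.1 (mem_coe.1 hA)).1
      (mem_powersetCard.1 (mem_coe.1 hB)).1 hAB
  rw [setOf_greenCount_eq n g b, setOf_greenCount_eq_and,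
    measureReal_biUnion_finset (hdisj _ n.le_succ) fun _ _ => measurableSet_prefixCylinder _ _,
    measureReal_biUnion_finset (hdisj _ le_rfl) fun _ _ => measurableSet_prefixCylinder _ _,
    Finset.sum_mul]
  refine Finset.sum_congr rfl fun A hA => ?_
  obtain ⟨hAn, rfl⟩ := mem_powersetCard.1 hA
  have h1 := hP (n + 1) (trajectoryOf n b A)
  rw [Finset.prod_range_succ, ← hP n] at h1
  refine h1.trans ?_
  simp only [stepProb, Gw, Rw, greenCount_trajectoryOf b hAn, prefixCylinder, measureReal_def]
  cases b <;> simp [trajectoryOf]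

lemma visitProb_zero_zero : visitProb P 0 0 = 1 := by
  simp [visitProb, greenCount]

lemma visitProb_succ_zero (hP : IsTwoEdgeLaw w 1 1 P) (a : ℕ) :
    visitProb P (a + 1) 0 = visitProb P a 0 * (w (1 + a) / (w (1 + a) + w 1)) := by
  have h := hP.measureReal_greenCount_and a a true
  have e : {ω : ℕ → Bool | greenCount ω (a + 1) = a + 1} =
      {ω | greenCount ω a = a ∧ ω a = true} := by
    ext ω
    have := greenCount_le ω a
    simp only [Set.mem_ofPred_eq, greenCount_succ]
    split_ifs with h <;> simp [h] ; omega
  simp only [visitProb, add_zero]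
  rw [e, h]
  simp

lemma visitProb_zero_succ (hP : IsTwoEdgeLaw w 1 1 P) (b : ℕ) :
    visitProb P 0 (b + 1) = visitProb P 0 b * (w (1 + b) / (w 1 + w (1 + b))) := by
  have h := hP.measureReal_greenCount_and b 0 false
  have e : {ω : ℕ → Bool | greenCount ω (b + 1) = 0} =
      {ω | greenCount ω b = 0 ∧ ω b = false} := by
    ext ω
    simp only [Set.mem_ofPred_eq, greenCount_succ]
    split_ifs with h <;> simp [h]
  simp only [visitProb, zero_add]
  rw [e, h]
  simp

lemma visitProb_succ_succ (hP : IsTwoEdgeLaw w 1 1 P) (a b : ℕ) :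
    visitProb P (a + 1) (b + 1) =
      visitProb P a (b + 1) * (w (1 + a) / (w (1 + a) + w (1 + (b + 1)))) +
      visitProb P (a + 1) b * (w (1 + b) / (w (1 + (a + 1)) + w (1 + b))) := by
  have h1 := hP.measureReal_greenCount_and (a + (b + 1)) a true
  have h2 := hP.measureReal_greenCount_and (a + 1 + b) (a + 1) false
  have e : {ω : ℕ → Bool | greenCount ω (a + 1 + (b + 1)) = a + 1} =
      {ω | greenCount ω (a + (b + 1)) = a ∧ ω (a + (b + 1)) = true} ∪
      {ω | greenCount ω (a + 1 + b) = a + 1 ∧ ω (a + 1 + b) = false} := by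
    ext ω
    have e1 : a + (b + 1) = a + 1 + b := by omega
    simp only [Set.mem_ofPred_eq, Set.mem_union, e1, ← add_assoc (a + 1) b 1, greenCount_succ]
    split_ifs with h <;> simp [h]
  have hd : Disjoint {ω : ℕ → Bool | greenCount ω (a + (b + 1)) = a ∧ ω (a + (b + 1)) = true}
      {ω | greenCount ω (a + 1 + b) = a + 1 ∧ ω (a + 1 + b) = false} := by
    rw [Set.disjoint_left]
    rintro ω ⟨h3, -⟩ ⟨h4, -⟩
    rw [show a + (b + 1) = a + 1 + b by omega] at h3
    omega
  have hm : MeasurableSet {ω : ℕ → Bool | greenCount ω (a + 1 + b) = a + 1 ∧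
      ω (a + 1 + b) = false} :=
    (measurableSet_greenCount_eq _ _).inter (measurableSet_apply_eq _ _)
  unfold visitProb
  rw [e, measureReal_union hd hm, h1, h2]
  simp

lemma normVisitProb_zero_zero : normVisitProb w P 0 0 = w 1 := by
  simp only [normVisitProb, visitProb_zero_zero, add_zero]
  rw [← add_div, div_div_eq_mul_div, mul_div_cancel_left₀ _ (by norm_num)]

lemma normVisitProb_zero (hw : ∀ k, 1 ≤ k → 0 < w k) (hP : IsTwoEdgeLaw w 1 1 P) (a : ℕ) :
    normVisitProb w P a 0 = w 1 * (visitProb P (a + 1) 0 + visitProb P 0 (a + 1)) := by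
  have h1 := hw (1 + a) (by omega)
  have h2 := hw 1 le_rfl
  rw [visitProb_succ_zero hP, visitProb_zero_succ hP, normVisitProb]
  simp only [add_zero]
  field_simp
  ring

lemma normVisitProb_succ_zero (hw : ∀ k, 1 ≤ k → 0 < w k) (hP : IsTwoEdgeLaw w 1 1 P) (a : ℕ) :
    normVisitProb w P (a + 1) 0 =
      normVisitProb w P a 0 * (w (1 + (a + 1)) / (w (1 + (a + 1)) + w 1)) := by
  have h1 := hw (1 + (a + 1)) (by omega)
  have h2 := hw 1 le_rfl
  rw [normVisitProb_zero hw hP a, normVisitProb]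
  simp only [add_zero]
  field_simp
  ring

lemma normVisitProb_succ_succ (hw : ∀ k, 1 ≤ k → 0 < w k) (hP : IsTwoEdgeLaw w 1 1 P)
    (a b : ℕ) :
    normVisitProb w P (a + 1) (b + 1) =
      (w (1 + (a + 1)) * normVisitProb w P a (b + 1) +
        w (1 + (b + 1)) * normVisitProb w P (a + 1) b) /
      (w (1 + (a + 1)) + w (1 + (b + 1))) := by
  have h1 := hw (1 + (a + 1)) (by omega)
  have h2 := hw (1 + (b + 1)) (by omega)
  have h3 := hw (1 + a) (by omega)
  have h4 := hw (1 + b) (by omega)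
  simp only [normVisitProb]
  rw [visitProb_succ_succ hP a b, visitProb_succ_succ hP b a]
  field_simp
  ring

lemma normVisitProb_le (hw : ∀ k, 1 ≤ k → 0 < w k) (hP : IsTwoEdgeLaw w 1 1 P) (a b : ℕ) :
    normVisitProb w P a b ≤ w 1 := by
  have hzero : ∀ a, normVisitProb w P a 0 ≤ w 1 := by
    intro a
    induction a with
    | zero => exact normVisitProb_zero_zero.le
    | succ a ih =>
      have h1 := hw (1 + (a + 1)) (by omega)
      have h2 := hw 1 le_rfl
      rw [normVisitProb_succ_zero hw hP]
      exact (mul_le_of_le_one_right (normVisitProb_nonneg hw _ _)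
        ((div_le_one (by positivity)).2 (by linarith))).trans ih
  induction a generalizing b with
  | zero => rw [normVisitProb_comm]; exact hzero b
  | succ a iha =>
    induction b with
    | zero => exact hzero _
    | succ b ihb =>
      have h1 := hw (1 + (a + 1)) (by omega)
      have h2 := hw (1 + (b + 1)) (by omega)
      rw [normVisitProb_succ_succ hw hP, div_le_iff₀ (by positivity)]
      nlinarith [mul_le_mul_of_nonneg_left (iha (b + 1)) h1.le,
        mul_le_mul_of_nonneg_left ihb h2.le]

lemma Z_add_two (ω : ℕ → Bool) (m : ℕ) :
    Z 1 1 ω (m + 2) = min (1 + greenCount ω m) (1 + (m - greenCount ω m)) := rfl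

lemma measureReal_Zinf_le (n : ℕ) :
    P.real {ω | Zinf 1 1 ω = 1} ≤ visitProb P (n + 1) 0 + visitProb P 0 (n + 1) := by
  unfold visitProb
  refine (measureReal_mono ?_).trans (measureReal_union_le _ _)
  intro ω hω
  have h : (Z 1 1 ω (n + 1 + 2) : ℕ∞) ≤ 1 := by
    rw [← show Zinf 1 1 ω = 1 from hω]
    exact le_iSup (fun n => (Z 1 1 ω n : ℕ∞)) _
  have h' : Z 1 1 ω (n + 1 + 2) ≤ 1 := by exact_mod_cast h
  rw [Z_add_two] at h'
  have := greenCount_le ω (n + 1)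
  simp only [Set.mem_union, Set.mem_ofPred_eq, add_zero, zero_add]
  omega

lemma mul_measureReal_Zinf_le_normVisitProb (hw : ∀ k, 1 ≤ k → 0 < w k)
    (hP : IsTwoEdgeLaw w 1 1 P) (a b : ℕ) :
    w 1 * P.real {ω | Zinf 1 1 ω = 1} ≤ normVisitProb w P a b := by
  have hzero : ∀ a, w 1 * P.real {ω | Zinf 1 1 ω = 1} ≤ normVisitProb w P a 0 := by
    intro a
    rw [normVisitProb_zero hw hP]
    exact mul_le_mul_of_nonneg_left (measureReal_Zinf_le a) (hw 1 le_rfl).le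
  induction a generalizing b with
  | zero => rw [normVisitProb_comm]; exact hzero b
  | succ a iha =>
    induction b with
    | zero => exact hzero _
    | succ b ihb =>
      have h1 := hw (1 + (a + 1)) (by omega)
      have h2 := hw (1 + (b + 1)) (by omega)
      rw [normVisitProb_succ_succ hw hP, le_div_iff₀ (by positivity)]
      nlinarith [mul_le_mul_of_nonneg_left (iha (b + 1)) h1.le,
        mul_le_mul_of_nonneg_left ihb h2.le]

lemma measureReal_Z_eq (a b : ℕ) (hab : b < a) :
    P.real {ω | Z 1 1 ω (a + b + 2) = b + 1} = visitProb P a b + visitProb P b a := by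
  have e : {ω : ℕ → Bool | Z 1 1 ω (a + b + 2) = b + 1} =
      {ω | greenCount ω (a + b) = a} ∪ {ω | greenCount ω (b + a) = b} := by
    ext ω
    have := greenCount_le ω (a + b)
    simp only [Set.mem_union, Set.mem_ofPred_eq, Z_add_two, add_comm b a]
    omega
  rw [e, measureReal_union _ (measurableSet_greenCount_eq _ _)]
  · rfl
  · rw [Set.disjoint_left]
    intro ω h1 h2
    simp only [Set.mem_ofPred_eq, add_comm b a] at h1 h2
    omega

lemma measureReal_Z_eq_mul (hw : ∀ k, 1 ≤ k → 0 < w k) (a b : ℕ) (hab : b < a) :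
    P.real {ω | Z 1 1 ω (a + b + 2) = b + 1} =
      normVisitProb w P a b *
        ((w (1 + a) + w (1 + b)) / (w (1 + a) * w (1 + b))) := by
  have h1 := hw (1 + a) (by omega)
  have h2 := hw (1 + b) (by omega)
  rw [measureReal_Z_eq a b hab, normVisitProb]
  field_simp
  ring

end AttractionTime

open AttractionTime

/-- Proposition 2(a): for `P = P^{1,1}`,
`c := sup_{k≥2} (w(k-1)+w(1))/w(k-1)`, `k ≥ 3` and `1 ≤ ℓ < k/2`,
`(w(1)/c)·P(Z_∞=1)·(w(k-ℓ)+w(ℓ))/(w(k-ℓ)w(ℓ)) ≤ P(Z_k = ℓ)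
  ≤ w(1)·(w(k-ℓ)+w(ℓ))/(w(k-ℓ)w(ℓ))`. -/
theorem stmt0 (w : ℕ → ℝ) (hw : ∀ k, 1 ≤ k → 0 < w k)
    (hA0 : Summable fun k : ℕ => 1 / w (k + 1))
    (P : Measure (ℕ → Bool)) [IsProbabilityMeasure P]
    (hP : IsTwoEdgeLaw w 1 1 P)
    (c : ℝ) (hc : c = sSup {x : ℝ | ∃ k : ℕ, 2 ≤ k ∧ x = (w (k - 1) + w 1) / w (k - 1)})
    (k ℓ : ℕ) (hk : 3 ≤ k) (hℓ : 1 ≤ ℓ) (hℓk : 2 * ℓ < k) :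
    w 1 / c * (P {ω | Zinf 1 1 ω = 1}).toReal * ((w (k - ℓ) + w ℓ) / (w (k - ℓ) * w ℓ))
        ≤ (P {ω | Z 1 1 ω k = ℓ}).toReal ∧
      (P {ω | Z 1 1 ω k = ℓ}).toReal
        ≤ w 1 * ((w (k - ℓ) + w ℓ) / (w (k - ℓ) * w ℓ)) := by
  have hc' : w 1 / c ≤ w 1 := by
    have h1 := hw 1 le_rfl
    by_cases hb : BddAbove {x : ℝ | ∃ k : ℕ, 2 ≤ k ∧ x = (w (k - 1) + w 1) / w (k - 1)}
    · refine div_le_self h1.le ?_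
      rw [hc]
      refine le_trans ?_ (le_csSup hb ⟨2, le_rfl, rfl⟩)
      rw [le_div_iff₀ h1]
      linarith
    · rw [hc, Real.sSup_of_not_bddAbove hb]
      simpa using h1.le
  obtain ⟨b, rfl⟩ : ∃ b, ℓ = b + 1 := ⟨ℓ - 1, by omega⟩
  obtain ⟨a, rfl⟩ : ∃ a, k = a + b + 2 := ⟨k - b - 2, by omega⟩
  have hZ := measureReal_Z_eq_mul (P := P) hw a b (by omega)
  have hlow := mul_measureReal_Zinf_le_normVisitProb hw hP a b
  have hup := normVisitProb_le hw hP a b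
  rw [show a + b + 2 - (b + 1) = 1 + a by omega, add_comm b 1] at *
  simp only [← measureReal_def]
  have h1 := hw (1 + a) (by omega)
  have h2 := hw (1 + b) (by omega)
  rw [hZ]
  refine ⟨mul_le_mul_of_nonneg_right ?_ (by positivity),
    mul_le_mul_of_nonneg_right hup (by positivity)⟩
  exact (mul_le_mul_of_nonneg_right hc' measureReal_nonneg).trans hlow
end

section
/- Let c̄ := max( sup_{k≥2, k even} (w(k)+w(1))/w(k), sup_{k≥1, k odd} (w(k)+w(2))/w(k) ) (finite under (A0)). Then for every integer k ≥ 1 and all integers o, e with o odd, o ≥ 1, e even, e ≥ 2 and o + e = 2k+1, one has P̄^{1,2}(G_{2k+1} = o, R_{2k+1} = e) ≤ (max(w(1), w(2)))·(w(o)+w(e))/(w(o)w(e)), and (min(w(1), w(2))/c̄)·P̄^{1,2}(Z_∞ = 1)·P̄^{1,2}(Z_∞ = 2)·(w(o)+w(e))/(w(o)w(e)) ≤ P̄^{1,2}(G_{2k+1} = o, R_{2k+1} = e). -/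
/-!
Setup for the law `P̄^{a,b}` (Cotar–Limic, "Attraction time for strongly
reinforced walks"): the ERRW on the two-edge graph with vertices `-1, 0, 1`,
started at the central vertex `0` and observed at successive returns to `0`.
It is the Markov chain `(G_n, R_n)` indexed by `n ∈ {a+b, a+b+2, ...}` with
`(G_{a+b}, R_{a+b}) = (a,b)`, moving from `(g,r)` to `(g+2,r)` with probability
`w(g)/(w(g)+w(r))` and to `(g,r+2)` with probability `w(r)/(w(g)+w(r))`.
Trajectories are encoded by the sequence of choices `ω : ℕ → Bool` (`true` =
green edge incremented), and the law is characterized by cylinder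
probabilities.
-/

open MeasureTheory Finset

namespace AttractionTimeBar

/-- Number of green increments among the first `i` (double-)steps. -/
def greenCount (ω : ℕ → Bool) (i : ℕ) : ℕ :=
  ((Finset.range i).filter fun j => ω j = true).card

/-- Green edge weight after `i` double-steps, starting from `a`. -/
def Gw (a : ℕ) (ω : ℕ → Bool) (i : ℕ) : ℕ := a + 2 * greenCount ω i

/-- Red edge weight after `i` double-steps, starting from `b`. -/
def Rw (b : ℕ) (ω : ℕ → Bool) (i : ℕ) : ℕ := b + 2 * (i - greenCount ω i)

/-- Transition probability of the `i`-th double-step of the trajectory `s`. -/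
noncomputable def stepProb (w : ℕ → ℝ) (a b : ℕ) (s : ℕ → Bool) (i : ℕ) : ℝ :=
  if s i then w (Gw a s i) / (w (Gw a s i) + w (Rw b s i))
  else w (Rw b s i) / (w (Gw a s i) + w (Rw b s i))

/-- `Z_n = min (G_n, R_n)`, where the time `n ∈ {a+b, a+b+2, ...}` corresponds
to `(n - (a+b))/2` double-steps. -/
def Z (a b : ℕ) (ω : ℕ → Bool) (n : ℕ) : ℕ :=
  min (Gw a ω ((n - (a + b)) / 2)) (Rw b ω ((n - (a + b)) / 2))

/-- `Z_∞ = sup_n Z_n ∈ ℕ ∪ {∞}`. -/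
noncomputable def Zinf (a b : ℕ) (ω : ℕ → Bool) : ℕ∞ :=
  ⨆ i, (min (Gw a ω i) (Rw b ω i) : ℕ∞)

/-- The law `P̄^{a,b}` : a probability measure on trajectories whose cylinder
probabilities are the products of the transition probabilities. -/
def IsTwoEdgeBarLaw (w : ℕ → ℝ) (a b : ℕ) (P : Measure (ℕ → Bool)) : Prop :=
  ∀ (m : ℕ) (s : ℕ → Bool),
    (P {ω | ∀ i < m, ω i = s i}).toReal = ∏ i ∈ Finset.range m, stepProb w a b s i

end AttractionTimeBar

open AttractionTimeBar

namespace AttractionTimeBar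

lemma greenCount_succ (ω : ℕ → Bool) (m : ℕ) :
    greenCount ω (m + 1) = greenCount ω m + if ω m = true then 1 else 0 := by
  unfold greenCount
  rw [Finset.range_add_one, Finset.filter_insert]
  split_ifs <;> simp

lemma greenCount_congr {ω ω' : ℕ → Bool} {m : ℕ} (h : ∀ i < m, ω i = ω' i) :
    greenCount ω m = greenCount ω' m := by
  unfold greenCount
  congr 1
  refine Finset.filter_congr fun i hi => ?_
  rw [h i (Finset.mem_range.1 hi)]

lemma greenCount_le (ω : ℕ → Bool) (m : ℕ) : greenCount ω m ≤ m :=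
  (Finset.card_filter_le _ _).trans (Finset.card_range m).le

lemma greenCount_mono (ω : ℕ → Bool) : Monotone (greenCount ω) :=
  monotone_nat_of_le_succ fun m => by rw [greenCount_succ]; omega

lemma greenCount_add_le (ω : ℕ → Bool) (m n : ℕ) :
    greenCount ω (m + n) ≤ greenCount ω m + n := by
  induction n with
  | zero => rfl
  | succ n ih => rw [← add_assoc, greenCount_succ]; split_ifs <;> omega

lemma greenCount_eq_zero {ω : ℕ → Bool} {m : ℕ} (h : ∀ i < m, ω i = false) :
    greenCount ω m = 0 := by
  simpa [greenCount] using h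

lemma greenCount_eq_self {ω : ℕ → Bool} {m : ℕ} (h : ∀ i < m, ω i = true) :
    greenCount ω m = m := by
  unfold greenCount
  rw [Finset.filter_true_of_mem fun i hi => h i (Finset.mem_range.1 hi), Finset.card_range]

lemma stepProb_congr (w : ℕ → ℝ) (a b : ℕ) {s t : ℕ → Bool} {i : ℕ}
    (h : ∀ j < i + 1, s j = t j) : stepProb w a b s i = stepProb w a b t i := by
  have hc : greenCount s i = greenCount t i := greenCount_congr fun j hj => h j (by omega)
  simp only [stepProb, Gw, Rw, hc, h i (by omega)]

/-- The event that the first `m` choices are those of `s`. -/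
def cylinder (m : ℕ) (s : ℕ → Bool) : Set (ℕ → Bool) := {ω | ∀ i < m, ω i = s i}

lemma measureReal_eq_sum_inter_cylinder (P : Measure (ℕ → Bool)) [IsProbabilityMeasure P]
    (A : Set (ℕ → Bool)) (m : ℕ) :
    P.real A = ∑ s : Fin m → Bool,
      P.real (cylinder m (fun i => if h : i < m then s ⟨i, h⟩ else false) ∩ A) := by
  let f : (ℕ → Bool) → Fin m → Bool := fun ω j => ω j
  have hf : Measurable f := by fun_prop
  have hpre (s : Fin m → Bool) :
      cylinder m (fun i => if h : i < m then s ⟨i, h⟩ else false) = f ⁻¹' {s} := by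
    ext ω
    simp only [cylinder, Set.mem_ofPred_eq, Set.mem_preimage, Set.mem_singleton_iff, funext_iff, f]
    constructor
    · intro h j
      simpa using h j j.2
    · intro h i hi
      simpa [hi] using h ⟨i, hi⟩
  have hm (s : Fin m → Bool) : MeasurableSet (f ⁻¹' {s}) := hf (MeasurableSet.singleton s)
  have key := sum_measureReal_preimage_singleton (μ := P.restrict A) (Finset.univ)
    (f := f) (fun s _ => hm s)
  simp only [Finset.coe_univ, Set.preimage_univ] at key
  rw [measureReal_restrict_apply MeasurableSet.univ, Set.univ_inter] at key
  rw [← key]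
  refine Finset.sum_congr rfl fun s _ => ?_
  rw [hpre, measureReal_restrict_apply (hm s)]

lemma IsTwoEdgeBarLaw.real_cylinder_succ {w : ℕ → ℝ} {a b : ℕ} {P : Measure (ℕ → Bool)}
    (hP : IsTwoEdgeBarLaw w a b P) (m : ℕ) (s : ℕ → Bool) :
    P.real (cylinder (m + 1) s) = P.real (cylinder m s) * stepProb w a b s m := by
  have h (n : ℕ) : P.real (cylinder n s) = _ := hP n s
  rw [h, h, Finset.prod_range_succ]

/-- The Markov property at a prescribed state. -/
lemma IsTwoEdgeBarLaw.real_greenCount_and {w : ℕ → ℝ} {a b : ℕ} {P : Measure (ℕ → Bool)}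
    [IsProbabilityMeasure P] (hP : IsTwoEdgeBarLaw w a b P) (i j : ℕ) (c : Bool) :
    P.real {ω | greenCount ω (i + j) = i ∧ ω (i + j) = c} =
      P.real {ω | greenCount ω (i + j) = i} *
        ((if c then w (a + 2 * i) else w (b + 2 * j)) / (w (a + 2 * i) + w (b + 2 * j))) := by
  rw [measureReal_eq_sum_inter_cylinder P _ (i + j),
    measureReal_eq_sum_inter_cylinder P {ω | greenCount ω (i + j) = i} (i + j), Finset.sum_mul]
  refine Finset.sum_congr rfl fun s _ => ?_
  set t : ℕ → Bool := fun l => if h : l < i + j then s ⟨l, h⟩ else false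
  by_cases ht : greenCount t (i + j) = i
  · set u : ℕ → Bool := fun l => if l < i + j then t l else c
    have hu (l : ℕ) (hl : l < i + j) : u l = t l := if_pos hl
    have huc : u (i + j) = c := if_neg (lt_irrefl _)
    have hA : cylinder (i + j) t ∩ {ω | greenCount ω (i + j) = i} = cylinder (i + j) u := by
      ext ω
      simp only [cylinder, Set.mem_inter_iff, Set.mem_ofPred_eq]
      constructor
      · rintro ⟨h, -⟩ l hl
        rw [h l hl, hu l hl]
      · intro h
        have h' : ∀ l < i + j, ω l = t l := fun l hl => (h l hl).trans (hu l hl)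
        exact ⟨h', (greenCount_congr h').trans ht⟩
    have hB : cylinder (i + j) t ∩ {ω | greenCount ω (i + j) = i ∧ ω (i + j) = c} =
        cylinder (i + j + 1) u := by
      rw [Set.ofPred_and, ← Set.inter_assoc, hA]
      ext ω
      simp only [cylinder, Set.mem_inter_iff, Set.mem_ofPred_eq, Nat.lt_succ_iff_lt_or_eq]
      constructor
      · rintro ⟨h, hc⟩ l (hl | rfl)
        · exact h l hl
        · rw [hc, huc]
      · intro h
        exact ⟨fun l hl => h l (Or.inl hl), (h _ (Or.inr rfl)).trans huc⟩
    have hcount : greenCount u (i + j) = i := (greenCount_congr hu).trans ht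
    rw [hA, hB, hP.real_cylinder_succ]
    simp only [stepProb, Gw, Rw, hcount, huc, Nat.add_sub_cancel_left]
    cases c <;> simp
  · have hempty : cylinder (i + j) t ∩ {ω | greenCount ω (i + j) = i} = ∅ := by
      ext ω
      simp only [Set.mem_inter_iff, Set.mem_ofPred_eq, Set.mem_empty_iff_false, iff_false, not_and]
      intro h h'
      exact ht ((greenCount_congr h).symm.trans h')
    rw [hempty, Set.ofPred_and, ← Set.inter_assoc, hempty]
    simp

/-- One-step decomposition of the probability of visiting an interior state. -/
lemma IsTwoEdgeBarLaw.real_greenCount_succ {w : ℕ → ℝ} {a b : ℕ} {P : Measure (ℕ → Bool)}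
    [IsProbabilityMeasure P] (hP : IsTwoEdgeBarLaw w a b P) (i j : ℕ) :
    P.real {ω | greenCount ω (i + 1 + (j + 1)) = i + 1} =
      P.real {ω | greenCount ω (i + (j + 1)) = i} *
          (w (a + 2 * i) / (w (a + 2 * i) + w (b + 2 * (j + 1)))) +
        P.real {ω | greenCount ω (i + 1 + j) = i + 1} *
          (w (b + 2 * j) / (w (a + 2 * (i + 1)) + w (b + 2 * j))) := by
  have h1 := hP.real_greenCount_and i (j + 1) true
  have h2 := hP.real_greenCount_and (i + 1) j false
  simp only [if_true, Bool.false_eq_true, if_false] at h1 h2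
  have hm : MeasurableSet {ω : ℕ → Bool | ω (i + (j + 1)) = true} :=
    measurableSet_eq_fun (measurable_pi_apply _) measurable_const
  rw [← h1, ← h2, ← measureReal_inter_add_sdiff hm]
  congr 2
  · ext ω
    have h := greenCount_succ ω (i + (j + 1))
    rw [show i + (j + 1) + 1 = i + 1 + (j + 1) by omega] at h
    simp only [Set.mem_inter_iff, Set.mem_ofPred_eq]
    refine and_congr_left fun hω => ?_
    rw [h, if_pos hω, Nat.add_right_cancel_iff]
  · ext ω
    have h := greenCount_succ ω (i + (j + 1))
    rw [show i + (j + 1) + 1 = i + 1 + (j + 1) by omega] at h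
    rw [show i + 1 + j = i + (j + 1) by omega]
    simp only [Set.mem_sdiff, Set.mem_ofPred_eq, Bool.not_eq_true]
    refine and_congr_left fun hω => ?_
    rw [h, hω]
    simp

lemma mul_inv_add_inv_mul_div {x y : ℝ} (hx : 0 < x) (hy : 0 < y) (c : ℝ) :
    c * (x⁻¹ + y⁻¹) * (x / (x + y)) = c * y⁻¹ := by
  field_simp
  ring

lemma IsTwoEdgeBarLaw.real_greenCount_le {w : ℕ → ℝ} {a b : ℕ} {P : Measure (ℕ → Bool)}
    [IsProbabilityMeasure P] (hP : IsTwoEdgeBarLaw w a b P) (hwa : ∀ i, 0 < w (a + 2 * i))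
    (hwb : ∀ j, 0 < w (b + 2 * j)) (i j : ℕ) :
    P.real {ω | greenCount ω (i + j) = i} ≤
      max (w a) (w b) * ((w (a + 2 * i))⁻¹ + (w (b + 2 * j))⁻¹) := by
  have ha : 0 < w a := hwa 0
  have hb : 0 < w b := hwb 0
  induction i generalizing j with
  | zero =>
    have h1 : (1 : ℝ) ≤ max (w a) (w b) * (w a)⁻¹ := by
      rw [← div_eq_mul_inv, one_le_div ha]
      exact le_max_left _ _
    have h2 : 0 ≤ max (w a) (w b) * (w (b + 2 * j))⁻¹ :=
      mul_nonneg (ha.le.trans (le_max_left _ _)) (inv_nonneg.2 (hwb j).le)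
    rw [mul_add]
    exact measureReal_le_one.trans (h1.trans (le_add_of_nonneg_right h2))
  | succ i ihi =>
    induction j with
    | zero =>
      have h1 : (1 : ℝ) ≤ max (w a) (w b) * (w b)⁻¹ := by
        rw [← div_eq_mul_inv, one_le_div hb]
        exact le_max_right _ _
      have h2 : 0 ≤ max (w a) (w b) * (w (a + 2 * (i + 1)))⁻¹ :=
        mul_nonneg (ha.le.trans (le_max_left _ _)) (inv_nonneg.2 (hwa _).le)
      rw [mul_add]
      exact measureReal_le_one.trans (h1.trans (le_add_of_nonneg_left h2))
    | succ j ihj =>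
      have hp := hwa i
      have hq := hwb (j + 1)
      have hr := hwa (i + 1)
      have hs := hwb j
      rw [hP.real_greenCount_succ]
      have h1 := mul_le_mul_of_nonneg_right (ihi (j + 1)) (div_pos hp (add_pos hp hq)).le
      have h2 := mul_le_mul_of_nonneg_right ihj (div_pos hs (add_pos hr hs)).le
      rw [mul_inv_add_inv_mul_div hp hq] at h1
      rw [add_comm (w (a + 2 * (i + 1)))⁻¹, add_comm (w (a + 2 * (i + 1))),
        mul_inv_add_inv_mul_div hs hr] at h2
      rw [add_comm (w (a + 2 * (i + 1))) (w (b + 2 * j))]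
      linarith

/-- A lower bound valid along the two axes propagates to the interior. -/
lemma IsTwoEdgeBarLaw.le_real_greenCount {w : ℕ → ℝ} {a b : ℕ} {P : Measure (ℕ → Bool)}
    [IsProbabilityMeasure P] (hP : IsTwoEdgeBarLaw w a b P) (hwa : ∀ i, 0 < w (a + 2 * i))
    (hwb : ∀ j, 0 < w (b + 2 * j)) {c : ℝ}
    (hca : ∀ j, c ≤ w a * P.real {ω | greenCount ω j = 0 ∧ ω j = false})
    (hcb : ∀ i, c ≤ w b * P.real {ω | greenCount ω i = i ∧ ω i = true}) (i j : ℕ) :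
    c * ((w (a + 2 * i))⁻¹ + (w (b + 2 * j))⁻¹) ≤ P.real {ω | greenCount ω (i + j) = i} := by
  induction i generalizing j with
  | zero =>
    have h := hP.real_greenCount_and 0 j false
    have hx := hwa 0
    have hy := hwb j
    have hc := hca j
    simp only [zero_add, mul_zero, add_zero, Bool.false_eq_true, if_false] at h hx ⊢
    rw [h] at hc
    refine (mul_le_mul_of_nonneg_right hc (by positivity)).trans (le_of_eq ?_)
    field_simp
    ring
  | succ i ihi =>
    induction j with
    | zero =>
      have h := hP.real_greenCount_and (i + 1) 0 true
      have hx := hwa (i + 1)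
      have hy := hwb 0
      have hc := hcb (i + 1)
      simp only [mul_zero, add_zero, if_true] at h hy ⊢
      rw [h] at hc
      refine (mul_le_mul_of_nonneg_right hc (by positivity)).trans (le_of_eq ?_)
      field_simp
      ring
    | succ j ihj =>
      have hp := hwa i
      have hq := hwb (j + 1)
      have hr := hwa (i + 1)
      have hs := hwb j
      rw [hP.real_greenCount_succ]
      have h1 := mul_le_mul_of_nonneg_right (ihi (j + 1)) (div_pos hp (add_pos hp hq)).le
      have h2 := mul_le_mul_of_nonneg_right ihj (div_pos hs (add_pos hr hs)).le
      rw [mul_inv_add_inv_mul_div hp hq] at h1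
      rw [add_comm (w (a + 2 * (i + 1)))⁻¹, add_comm (w (a + 2 * (i + 1))),
        mul_inv_add_inv_mul_div hs hr] at h2
      rw [add_comm (w (a + 2 * (i + 1))) (w (b + 2 * j))]
      linarith

lemma min_le_of_Zinf_eq {a b n : ℕ} {ω : ℕ → Bool} (h : Zinf a b ω = n) (i : ℕ) :
    min (Gw a ω i) (Rw b ω i) ≤ n := by
  have h1 : (min (Gw a ω i) (Rw b ω i) : ℕ∞) ≤ n :=
    h ▸ le_iSup (fun i => (min (Gw a ω i) (Rw b ω i) : ℕ∞)) i
  rw [min_le_iff] at h1 ⊢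
  exact_mod_cast h1

lemma eq_false_of_Zinf_eq_one {ω : ℕ → Bool} (h : Zinf 1 2 ω = 1) (i : ℕ) : ω i = false := by
  by_contra hi
  rw [Bool.not_eq_false] at hi
  have h1 := min_le_of_Zinf_eq (n := 1) (by exact_mod_cast h) (i + 1)
  have h2 := greenCount_succ ω i
  rw [if_pos hi] at h2
  simp only [Gw, Rw] at h1
  omega

lemma eq_true_of_Zinf_eq_two {ω : ℕ → Bool} (h : Zinf 1 2 ω = 2) (i : ℕ) : ω i = true := by
  by_contra hi
  rw [Bool.not_eq_true] at hi
  have hbound : ∀ n, greenCount ω n = 0 := by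
    intro n
    have h1 := min_le_of_Zinf_eq (n := 2) (by exact_mod_cast h) (i + 1 + n)
    have h2 := greenCount_succ ω i
    rw [hi, if_neg Bool.false_ne_true] at h2
    have h3 := greenCount_le ω i
    have h4 := greenCount_add_le ω (i + 1) n
    have h5 := greenCount_mono ω (Nat.le_add_left n (i + 1))
    simp only [Gw, Rw] at h1
    omega
  have hle : Zinf 1 2 ω ≤ 1 := by
    refine iSup_le fun n => (min_le_left _ _).trans ?_
    simp [Gw, hbound n]
  rw [h] at hle
  exact absurd hle (by decide)

lemma sSup_eq_zero_or_one_le {S : Set ℝ} (hne : S.Nonempty) (h : ∀ x ∈ S, 1 ≤ x) :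
    sSup S = 0 ∨ 1 ≤ sSup S := by
  by_cases hb : BddAbove S
  · obtain ⟨x, hx⟩ := hne
    exact Or.inr ((h x hx).trans (le_csSup hb hx))
  · exact Or.inl (Real.sSup_of_not_bddAbove hb)

end AttractionTimeBar

/-- Proposition 3: for `P = P̄^{1,2}`,
`c̄ := max(sup_{k≥2 even} (w(k)+w(1))/w(k), sup_{k≥1 odd} (w(k)+w(2))/w(k))`,
every `k ≥ 1` and all `o` odd, `e` even with `o + e = 2k+1`:
`P̄(G_{2k+1}=o, R_{2k+1}=e) ≤ max(w(1),w(2))·(w(o)+w(e))/(w(o)w(e))` and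
`(min(w(1),w(2))/c̄)·P̄(Z_∞=1)·P̄(Z_∞=2)·(w(o)+w(e))/(w(o)w(e))
  ≤ P̄(G_{2k+1}=o, R_{2k+1}=e)`.
(Time `2k+1` corresponds to `k-1` double-steps since `a+b = 3`.) -/
theorem stmt2 (w : ℕ → ℝ) (hw : ∀ k, 1 ≤ k → 0 < w k)
    (hA0 : Summable fun k : ℕ => 1 / w (k + 1))
    (P : Measure (ℕ → Bool)) [IsProbabilityMeasure P]
    (hP : IsTwoEdgeBarLaw w 1 2 P)
    (cbar : ℝ)
    (hcbar : cbar =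
      max (sSup {x : ℝ | ∃ k : ℕ, 2 ≤ k ∧ Even k ∧ x = (w k + w 1) / w k})
        (sSup {x : ℝ | ∃ k : ℕ, 1 ≤ k ∧ Odd k ∧ x = (w k + w 2) / w k}))
    (k o e : ℕ) (hk : 1 ≤ k) (ho₁ : Odd o) (ho₂ : 1 ≤ o) (he₁ : Even e)
    (he₂ : 2 ≤ e) (hoe : o + e = 2 * k + 1) :
    (P {ω | Gw 1 ω (k - 1) = o ∧ Rw 2 ω (k - 1) = e}).toReal
        ≤ max (w 1) (w 2) * ((w o + w e) / (w o * w e)) ∧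
      min (w 1) (w 2) / cbar * (P {ω | Zinf 1 2 ω = 1}).toReal *
          (P {ω | Zinf 1 2 ω = 2}).toReal * ((w o + w e) / (w o * w e))
        ≤ (P {ω | Gw 1 ω (k - 1) = o ∧ Rw 2 ω (k - 1) = e}).toReal := by
  obtain ⟨i, rfl⟩ : ∃ i, o = 1 + 2 * i := by obtain ⟨i, rfl⟩ := ho₁; exact ⟨i, by omega⟩
  obtain ⟨j, rfl⟩ : ∃ j, e = 2 + 2 * j := by
    obtain ⟨j, rfl⟩ := he₁; exact ⟨j - 1, by omega⟩
  obtain rfl : k = i + j + 1 := by omega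
  have hwa (i : ℕ) : 0 < w (1 + 2 * i) := hw _ (by omega)
  have hwb (j : ℕ) : 0 < w (2 + 2 * j) := hw _ (by omega)
  have h1 : 0 < w 1 := hw 1 le_rfl
  have h2 : 0 < w 2 := hw 2 one_le_two
  have hset : {ω | Gw 1 ω (i + j + 1 - 1) = 1 + 2 * i ∧ Rw 2 ω (i + j + 1 - 1) = 2 + 2 * j} =
      {ω | greenCount ω (i + j) = i} := by
    ext ω
    have := greenCount_le ω (i + j)
    simp only [Gw, Rw, Set.mem_ofPred_eq, Nat.add_sub_cancel]
    omega
  have hf : (w (1 + 2 * i) + w (2 + 2 * j)) / (w (1 + 2 * i) * w (2 + 2 * j)) =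
      (w (1 + 2 * i))⁻¹ + (w (2 + 2 * j))⁻¹ := by
    have := hwa i
    have := hwb j
    field_simp
    ring
  rw [hset, hf]
  refine ⟨hP.real_greenCount_le hwa hwb i j, ?_⟩
  have hc : min (w 1) (w 2) / cbar ≤ min (w 1) (w 2) := by
    have hone (k l : ℕ) (hk : 1 ≤ k) (hl : 1 ≤ l) : 1 ≤ (w k + w l) / w k := by
      rw [one_le_div (hw k hk)]
      exact le_add_of_nonneg_right (hw l hl).le
    have hS := sSup_eq_zero_or_one_le
      (S := {x : ℝ | ∃ k : ℕ, 2 ≤ k ∧ Even k ∧ x = (w k + w 1) / w k})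
      ⟨_, 2, le_rfl, even_two, rfl⟩
      (by rintro x ⟨k, hk, -, rfl⟩; exact hone k 1 (by omega) le_rfl)
    have hT := sSup_eq_zero_or_one_le
      (S := {x : ℝ | ∃ k : ℕ, 1 ≤ k ∧ Odd k ∧ x = (w k + w 2) / w k})
      ⟨_, 1, le_rfl, odd_one, rfl⟩
      (by rintro x ⟨k, hk, -, rfl⟩; exact hone k 2 hk one_le_two)
    have hmin : 0 ≤ min (w 1) (w 2) := le_min h1.le h2.le
    have hcb : cbar = 0 ∨ 1 ≤ cbar := by
      rw [hcbar]
      rcases hS with hS | hS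
      · rcases hT with hT | hT
        · left; rw [hS, hT, max_self]
        · exact Or.inr (le_max_of_le_right hT)
      · exact Or.inr (le_max_of_le_left hS)
    rcases hcb with h | h
    · rwa [h, div_zero]
    · exact div_le_self hmin h
  set p := P.real {ω | Zinf 1 2 ω = 1}
  set q := P.real {ω | Zinf 1 2 ω = 2}
  have hp0 : 0 ≤ p := measureReal_nonneg
  have hq0 : 0 ≤ q := measureReal_nonneg
  have hp1 : p ≤ 1 := measureReal_le_one
  have hq1 : q ≤ 1 := measureReal_le_one
  change min (w 1) (w 2) / cbar * p * q * _ ≤ P.real _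
  refine hP.le_real_greenCount hwa hwb (fun m => ?_) (fun m => ?_) i j
  · have hsub : p ≤ P.real {ω | greenCount ω m = 0 ∧ ω m = false} :=
      measureReal_mono fun ω hω =>
        ⟨greenCount_eq_zero fun l _ => eq_false_of_Zinf_eq_one hω l, eq_false_of_Zinf_eq_one hω m⟩
    calc min (w 1) (w 2) / cbar * p * q ≤ w 1 * p * 1 := by
          have := hc.trans (min_le_left _ _)
          gcongr
      _ = w 1 * p := mul_one _
      _ ≤ _ := by gcongr
  · have hsub : q ≤ P.real {ω | greenCount ω m = m ∧ ω m = true} :=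
      measureReal_mono fun ω hω =>
        ⟨greenCount_eq_self fun l _ => eq_true_of_Zinf_eq_two hω l, eq_true_of_Zinf_eq_two hω m⟩
    calc min (w 1) (w 2) / cbar * p * q ≤ w 2 * 1 * q := by
          have := hc.trans (min_le_right _ _)
          gcongr
      _ = w 2 * q := by rw [mul_one]
      _ ≤ _ := by gcongr
end

section
/- Assume (A0) and (A1). Then for all integers k ≥ 3 and 1 ≤ ℓ < k/2, ( w(k-ℓ)/(w(k-ℓ)+w(ℓ)) )·W_{k+1}(k+1-ℓ) ≤ 2·( w(ℓ)/(w(ℓ)+w(k-ℓ)) )·W_{k+1}(ℓ+1). (In terms of the two-edge walk, this says P(A_k^w | Z_k = ℓ) ≤ 2 P(A_k^s | Z_k = ℓ), where A_k^s is the event that the less traversed edge is chosen at time k and the other edge at all later times, and A_k^w the event that the more traversed edge is chosen at time k and the other edge at all later times.) -/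
/-!
Statement 11 (Corollary 8 of Cotar–Limic).  `w : ℕ → ℝ` is a positive
reinforcement weight function on `{1,2,...}` satisfying (A0):
`∑_{k≥1} 1/w(k) < ∞`, and (A1): `w` nondecreasing.  Here
`W_k(ℓ) := ∏_{j=0}^∞ w(k+j-ℓ)/(w(k+j-ℓ)+w(ℓ))`.
-/

namespace AttractionTime

/-- `W_k(ℓ) := ∏_{j=0}^∞ w(k+j-ℓ)/(w(k+j-ℓ)+w(ℓ))`. -/
noncomputable def W (w : ℕ → ℝ) (k ℓ : ℕ) : ℝ :=
  ∏' j : ℕ, w (k + j - ℓ) / (w (k + j - ℓ) + w ℓ)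

end AttractionTime

namespace AttractionTime

theorem tendsto_prod_range_div_add {w : ℕ → ℝ} (hw : ∀ k, 1 ≤ k → 0 < w k)
    (hA0 : Summable fun k : ℕ => 1 / w (k + 1)) {n : ℕ} (hn : 1 ≤ n) {c : ℝ} (hc : 0 < c) :
    Filter.Tendsto (fun N => ∏ j ∈ Finset.range N, w (n + j) / (w (n + j) + c)) Filter.atTop
      (nhds (∏' j : ℕ, w (n + j) / (w (n + j) + c))) := by
  have hs : Summable fun j : ℕ => c * (1 / w (n + j)) := by
    refine (((summable_nat_add_iff (n - 1)).2 hA0).congr fun j => ?_).mul_left c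
    rw [show j + (n - 1) + 1 = n + j by omega]
  have hm : Multipliable fun j : ℕ => 1 + -(c / (w (n + j) + c)) := by
    refine Real.multipliable_one_add_of_summable (Summable.of_norm_bounded hs fun j => ?_)
    have hp := hw (n + j) (by omega)
    rw [norm_neg, Real.norm_of_nonneg (by positivity), ← mul_one_div]
    gcongr
    linarith
  have he : (fun j : ℕ => 1 + -(c / (w (n + j) + c))) =
      fun j => w (n + j) / (w (n + j) + c) := by
    ext j
    have hp := hw (n + j) (by omega)
    field_simp
    ring
  rw [he] at hm
  exact hm.hasProd.tendsto_prod_nat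

theorem div_add_le_div_add {x y c d : ℝ} (hx : 0 < x) (hd : 0 < d) (hxy : x ≤ y) (hdc : d ≤ c) :
    x / (x + c) ≤ y / (y + d) := by
  rw [div_le_div_iff₀ (by linarith) (by linarith)]
  nlinarith [mul_le_mul hxy hdc hd.le (hx.le.trans hxy)]

end AttractionTime

open AttractionTime

/-- Corollary 8: under (A0) and (A1), for all `k ≥ 3` and
`1 ≤ ℓ < k/2`,
`(w(k-ℓ)/(w(k-ℓ)+w(ℓ)))·W_{k+1}(k+1-ℓ)
  ≤ 2·(w(ℓ)/(w(ℓ)+w(k-ℓ)))·W_{k+1}(ℓ+1)`,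
i.e. `P(A_k^w | Z_k = ℓ) ≤ 2·P(A_k^s | Z_k = ℓ)` for the two-edge walk. -/
theorem stmt11 (w : ℕ → ℝ) (hw : ∀ k, 1 ≤ k → 0 < w k)
    (hA0 : Summable fun k : ℕ => 1 / w (k + 1))
    (hA1 : ∀ k, 1 ≤ k → w k ≤ w (k + 1)) :
    ∀ k ℓ : ℕ, 3 ≤ k → 1 ≤ ℓ → 2 * ℓ < k →
      w (k - ℓ) / (w (k - ℓ) + w ℓ) * W w (k + 1) (k + 1 - ℓ)
        ≤ 2 * (w ℓ / (w ℓ + w (k - ℓ)) * W w (k + 1) (ℓ + 1)) := by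
  intro k ℓ _ hℓ hkℓ
  obtain ⟨m, rfl⟩ : ∃ m, k = m + ℓ := ⟨k - ℓ, by omega⟩
  have hmono : ∀ i j, 1 ≤ i → i ≤ j → w i ≤ w j := fun i j hi hij =>
    Nat.le_induction le_rfl (fun n hn ih => ih.trans (hA1 n (hi.trans hn))) j hij
  have ha := hw ℓ hℓ
  have hb := hw m (by omega)
  have hc := hw (m + 1) (by omega)
  have hd := hw (ℓ + 1) (by omega)
  have hdc := hmono (ℓ + 1) (m + 1) (by omega) (by omega)
  have hbc := hA1 m (by omega)
  have hF : W w (m + ℓ + 1) (m + ℓ + 1 - ℓ) = ∏' j : ℕ, w (ℓ + j) / (w (ℓ + j) + w (m + 1)) := by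
    refine tprod_congr fun j => ?_
    rw [show m + ℓ + 1 + j - (m + ℓ + 1 - ℓ) = ℓ + j by omega,
      show m + ℓ + 1 - ℓ = m + 1 by omega]
  have hG : W w (m + ℓ + 1) (ℓ + 1) = ∏' j : ℕ, w (m + j) / (w (m + j) + w (ℓ + 1)) := by
    refine tprod_congr fun j => ?_
    rw [show m + ℓ + 1 + j - (ℓ + 1) = m + j by omega]
  rw [hF, hG, Nat.add_sub_cancel]
  refine le_of_tendsto_of_tendsto'
    (((tendsto_prod_range_div_add hw hA0 hℓ hc).comp (Filter.tendsto_add_atTop_nat 1)).const_mul _)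
    (((tendsto_prod_range_div_add hw hA0 (by omega) hd).const_mul _).const_mul _) fun N => ?_
  simp only [Function.comp_apply, Finset.prod_range_succ', add_zero]
  have hle : ∏ j ∈ Finset.range N, w (ℓ + (j + 1)) / (w (ℓ + (j + 1)) + w (m + 1)) ≤
      ∏ j ∈ Finset.range N, w (m + j) / (w (m + j) + w (ℓ + 1)) := by
    refine Finset.prod_le_prod (fun j _ => ?_) fun j _ => ?_
    · have := hw (ℓ + (j + 1)) (by omega)
      positivity
    · exact div_add_le_div_add (hw _ (by omega)) hd (hmono _ _ (by omega) (by omega)) hdc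
  have hpos : 0 ≤ ∏ j ∈ Finset.range N, w (m + j) / (w (m + j) + w (ℓ + 1)) := by
    refine Finset.prod_nonneg fun j _ => ?_
    have := hw (m + j) (by omega)
    positivity
  generalize ∏ j ∈ Finset.range N, w (m + j) / (w (m + j) + w (ℓ + 1)) = Q at *
  have hcoef : w m / (w m + w ℓ) * (w ℓ / (w ℓ + w (m + 1))) ≤ w ℓ / (w ℓ + w m) := by
    rw [add_comm (w m), div_mul_div_comm, mul_comm (w m), mul_div_mul_comm]
    exact mul_le_of_le_one_right (by positivity)
      ((div_le_one (by positivity)).2 (by linarith))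
  calc _ ≤ w m / (w m + w ℓ) * (Q * (w ℓ / (w ℓ + w (m + 1)))) := by gcongr
    _ = w m / (w m + w ℓ) * (w ℓ / (w ℓ + w (m + 1))) * Q := by ring
    _ ≤ w ℓ / (w ℓ + w m) * Q := by gcongr
    _ ≤ _ := le_mul_of_one_le_left (by positivity) one_le_two
end
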